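/- arXiv:2211.03302 — 3 statements merged into one kernel-verified Lean document; each statement's English description precedes it below -/
import Mathlib

section
/- For a single task with binary state ω ∈ {0,1} uniform, cost of effort c > 0 and state-revelation probability p ∈ (0,1] (effort yields signal σ = ω with probability p and σ = ⊥ otherwise; no effort yields σ = ⊥), the scoring rule S defined by S(⊥, ω) = c/p and S(σ, ω) = (2c/p)·1{σ = ω} for σ ∈ {0,1} is proper, takes values in [0, 2c/p], and the mechanism (S, {task}) is incentive compatible: exerting effort and reporting truthfully yields expected utility (expected score minus cost) at least that of any other combination of effort choice and report. -/
/-! Single-task knapsack scoring: the budget-minimal scoring rule of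
Lemma "single opt" is proper, bounded by `2c/p`, and incentive compatible. -/

/-- Expectation of `f : Bool → ℝ` under the posterior induced by signal
`σ ∈ {0,1,⊥}`: point mass on `b` if `σ = some b`, uniform if `σ = none`. -/
noncomputable def postExp1 (σ : Option Bool) (f : Bool → ℝ) : ℝ :=
  σ.elim ((f true + f false) / 2) f

/-- Properness of a single-task scoring rule. -/
def Proper1 (S : Option Bool → Bool → ℝ) : Prop :=
  ∀ σ σ' : Option Bool, postExp1 σ (S σ) ≥ postExp1 σ (S σ')

/-- Expected utility of effort choice `e` and reporting strategy `r`: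
the state is uniform on `{0,1}`; with effort the agent sees `some ω` with
probability `p` and `none` otherwise; without effort he sees `none`;
effort costs `c`. -/
noncomputable def utility1 (p c : ℝ) (S : Option Bool → Bool → ℝ)
    (e : Bool) (r : Option Bool → Option Bool) : ℝ :=
  (1/2) * (∑ ω : Bool,
      (if e then p * S (r (some ω)) ω + (1 - p) * S (r none) ω
       else S (r none) ω))
    - (if e then c else 0)

theorem stmt0 (c p : ℝ) (hc : 0 < c) (hp0 : 0 < p) (hp1 : p ≤ 1)
    (S : Option Bool → Bool → ℝ)
    (hS : ∀ σ ω, S σ ω = σ.elim (c / p) (fun b => if b = ω then 2 * c / p else 0)) :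
    Proper1 S ∧ (∀ σ ω, S σ ω ∈ Set.Icc (0:ℝ) (2 * c / p)) ∧
      ∀ (e : Bool) (r : Option Bool → Option Bool),
        utility1 p c S true id ≥ utility1 p c S e r := by
  have hk : 0 < c / p := div_pos hc hp0
  have hpk : p * (c / p) = c := mul_div_cancel₀ c hp0.ne'
  have two_k : 2 * c / p = 2 * (c / p) := mul_div_assoc 2 c p
  have hsum : ∀ σ, S σ true + S σ false = 2 * (c / p) := by
    rintro (_ | _ | _) <;> simp [hS, two_k]; ring
  have hmem : ∀ σ ω, S σ ω ∈ Set.Icc (0 : ℝ) (2 * c / p) := by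
    rintro (_ | b) ω <;> simp only [hS, two_k, Option.elim_none, Option.elim_some]
    · constructor <;> linarith
    · split_ifs <;> constructor <;> linarith
  have hcorrect : ∀ ω, S (some ω) ω = 2 * c / p := by simp [hS]
  refine ⟨?_, hmem, ?_⟩
  · rintro (_ | b) σ'
    · simp only [postExp1, Option.elim_none, hsum, ge_iff_le, le_refl]
    · simpa only [postExp1, Option.elim_some, hcorrect] using (hmem σ' b).2
  · intro e r
    have hnone := hsum none
    have hr := hsum (r none)
    cases e
    · simp only [utility1, Fintype.sum_bool, id, hcorrect, two_k, if_true, Bool.false_eq_true,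
        if_false]
      linear_combination (1 / 2) * (hr - (1 - p) * hnone) - hpk
    · have ht := mul_le_mul_of_nonneg_left (hmem (r (some true)) true).2 hp0.le
      have hf := mul_le_mul_of_nonneg_left (hmem (r (some false)) false).2 hp0.le
      simp only [utility1, Fintype.sum_bool, id, hcorrect, if_true]
      linear_combination (1 / 2) * (ht + hf + (1 - p) * hr - (1 - p) * hnone)
end

section
/- For a single task with binary state uniform on {0,1}, cost of effort c > 0 and state-revelation probability p ∈ (0,1], if S : {0,1,⊥} × {0,1} → [0, B] is a proper scoring rule such that exerting effort and reporting truthfully yields expected utility at least that of exerting no effort and reporting ⊥, then B ≥ 2c/p. That is, 2c/p is the minimal budget with which effort on a single task can be incentivized. -/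
theorem stmt1 (c p B : ℝ) (hc : 0 < c) (hp0 : 0 < p) (hp1 : p ≤ 1)
    (S : Option Bool → Bool → ℝ)
    (hbd : ∀ σ ω, S σ ω ∈ Set.Icc (0:ℝ) B)
    (hproper : Proper1 S)
    (hIC : utility1 p c S true id ≥ utility1 p c S false (fun _ => none)) :
    B ≥ 2 * c / p := by
  have hnone_ge := hproper none (some true)
  have htrue := (hbd (some true) false).1
  have hfalse := (hbd (some false) false).2
  simp only [postExp1, Option.elim] at hnone_ge
  simp only [utility1, Fintype.sum_bool, id, if_true, Bool.false_eq_true, if_false] at hIC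
  have hgain : S (some true) true + S (some false) false
      - (S none true + S none false) ≤ B := by linarith
  rw [ge_iff_le, div_le_iff₀ hp0]
  linarith [mul_le_mul_of_nonneg_right hgain hp0.le]
end

section
/- (Monotonicity in tasks) For any set Ψ ⊆ [n], if there exists a proper scoring rule S with values in [0,1] such that the mechanism (S, Ψ) is incentive compatible, then for every subset Ψ' ⊆ Ψ there exists a proper scoring rule S' with values in [0,1] such that the mechanism (S', Ψ') is incentive compatible. -/
open Finset

namespace KS

abbrev Sig (n : ℕ) := Fin n → Option Bool
abbrev St (n : ℕ) := Fin n → Bool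

/-- Posterior probability of state profile `ω` induced by signal profile `σ`:
`ω i = b` with probability 1 when `σ i = some b`, uniform when `σ i = none`. -/
noncomputable def postProb {n : ℕ} (σ : Sig n) (ω : St n) : ℝ :=
  ∏ i, (σ i).elim ((1:ℝ)/2) (fun b => if ω i = b then 1 else 0)

/-- Expectation of `f` over states, under the posterior induced by `σ`. -/
noncomputable def postExp {n : ℕ} (σ : Sig n) (f : St n → ℝ) : ℝ :=
  ∑ ω : St n, postProb σ ω * f ω

/-- A scoring rule is proper if truthful reporting of the signal maximizes the
expected score under the induced posterior. -/
def Proper {n : ℕ} (S : Sig n → St n → ℝ) : Prop :=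
  ∀ σ σ' : Sig n, postExp σ (S σ) ≥ postExp σ (S σ')

/-- Probability of receiving signal profile `σ` when exerting effort exactly on `Ψ`
(with state-revelation probabilities `p`, states uniform and independent). -/
noncomputable def sigProb {n : ℕ} (p : Fin n → ℝ) (Ψ : Finset (Fin n)) (σ : Sig n) : ℝ :=
  ∏ i, if i ∈ Ψ then (σ i).elim (1 - p i) (fun _ => p i / 2)
       else (σ i).elim 1 (fun _ => 0)

/-- Expected score `E_{σ∼Ψ}[E_{ω∼σ}[S(σ,ω)]]` for exerting effort on `Ψ` and
truthfully reporting. -/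
noncomputable def expScore {n : ℕ} (p : Fin n → ℝ) (Ψ : Finset (Fin n))
    (S : Sig n → St n → ℝ) : ℝ :=
  ∑ σ : Sig n, sigProb p Ψ σ * postExp σ (S σ)

/-- Incentive compatibility of the mechanism `(S, Ψ)`. -/
def IC {n : ℕ} (p c : Fin n → ℝ) (S : Sig n → St n → ℝ) (Ψ : Finset (Fin n)) : Prop :=
  Proper S ∧ ∀ Ψ' : Finset (Fin n),
    expScore p Ψ S - ∑ i ∈ Ψ, c i ≥ expScore p Ψ' S - ∑ i ∈ Ψ', c i

/-- Truncated separate scoring rule with budget `B`. -/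
def IsTruncSep {n : ℕ} (B : ℝ) (S : Sig n → St n → ℝ) : Prop :=
  ∃ (T : Fin n → Option Bool → Bool → ℝ) (d : ℝ),
    ∀ σ ω, S σ ω = min B (max 0 (-d + ∑ i, T i (σ i) (ω i)))

open Classical in
/-- Threshold scoring rule with recommendation set `Ψ` and threshold `η`. -/
noncomputable def thresholdScore {n : ℕ} (Ψ : Finset (Fin n)) (η : ℕ)
    (σ : Sig n) (ω : St n) : ℝ :=
  if ∃ i ∈ Ψ, σ i ≠ none ∧ σ i ≠ some (ω i) then 0
  else if η ≤ (Ψ.filter fun i => σ i = some (ω i)).card then 1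
  else (1/2 : ℝ) ^ (η - (Ψ.filter fun i => σ i = some (ω i)).card)

def IsThreshold {n : ℕ} (S : Sig n → St n → ℝ) : Prop :=
  ∃ (Ψ : Finset (Fin n)) (η : ℕ), ∀ σ ω, S σ ω = thresholdScore Ψ η σ ω

end KS

namespace KS

section ProductWeights

variable {ι α R : Type*} [Fintype ι] [DecidableEq ι] [Fintype α] [CommSemiring R]

lemma sum_prod_eq_one {w : ι → α → R} (hw : ∀ i, ∑ a, w i a = 1) :
    ∑ x : ι → α, ∏ i, w i (x i) = 1 := by
  rw [← Fintype.prod_sum, Finset.prod_eq_one fun i _ => hw i]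

/-- Gluing independent samples from the product weights `w` and `v` along `D` gives a sample
from the glued product weight. -/
lemma sum_prod_mul_sum_prod_piecewise (D : Finset ι) {w v : ι → α → R}
    (hw : ∀ i, ∑ a, w i a = 1) (hv : ∀ i, ∑ a, v i a = 1) (f : (ι → α) → R) :
    ∑ x : ι → α, (∏ i, w i (x i)) * ∑ y : ι → α, (∏ i, v i (y i)) * f (D.piecewise y x) =
      ∑ z : ι → α, (∏ i, D.piecewise v w i (z i)) * f z := by
  have hone : ∑ y : ι → α, ∏ i, D.piecewise w v i (y i) = 1 :=
    sum_prod_eq_one fun i => by by_cases hi : i ∈ D <;> simp [hi, hw, hv]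
  let swap : (ι → α) × (ι → α) → (ι → α) × (ι → α) :=
    fun q => (D.piecewise q.2 q.1, D.piecewise q.1 q.2)
  have hswap : Function.Involutive swap := fun q => by
    ext i <;> by_cases hi : i ∈ D <;> simp [swap, hi]
  calc ∑ x : ι → α, (∏ i, w i (x i)) * ∑ y : ι → α, (∏ i, v i (y i)) * f (D.piecewise y x)
      = ∑ q : (ι → α) × (ι → α),
          (∏ i, w i (q.1 i)) * ((∏ i, v i (q.2 i)) * f (D.piecewise q.2 q.1)) := by
        simp_rw [Finset.mul_sum, Fintype.sum_prod_type]
    _ = ∑ q : (ι → α) × (ι → α),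
          (∏ i, D.piecewise v w i (q.1 i)) * f q.1 * ∏ i, D.piecewise w v i (q.2 i) := by
        refine Fintype.sum_equiv hswap.toPerm _ _ fun q => ?_
        have hprod : (∏ i, w i (q.1 i)) * ∏ i, v i (q.2 i) =
            (∏ i, D.piecewise v w i (D.piecewise q.2 q.1 i)) *
              ∏ i, D.piecewise w v i (D.piecewise q.1 q.2 i) := by
          simp_rw [← Finset.prod_mul_distrib]
          refine Finset.prod_congr rfl fun i _ => ?_
          by_cases hi : i ∈ D <;> simp [hi, mul_comm]
        simp only [Function.Involutive.coe_toPerm, swap]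
        rw [← mul_assoc, hprod]
        ring
    _ = ∑ z : ι → α, (∏ i, D.piecewise v w i (z i)) * f z := by
        simp_rw [Fintype.sum_prod_type, ← Finset.mul_sum, hone, mul_one]

end ProductWeights

variable {n : ℕ}

lemma sum_postWeight (s : Option Bool) :
    ∑ b : Bool, s.elim ((1 : ℝ) / 2) (fun b' => if b = b' then 1 else 0) = 1 := by
  rcases s with _ | _ | _ <;> norm_num

lemma sum_sigWeight (p : Fin n → ℝ) (A : Finset (Fin n)) (i : Fin n) :
    ∑ s : Option Bool, (if i ∈ A then s.elim (1 - p i) (fun _ => p i / 2)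
      else s.elim 1 (fun _ => 0)) = 1 := by
  by_cases hi : i ∈ A <;> simp [hi, Fintype.sum_option]
  ring

lemma postProb_nonneg (σ : Sig n) (ω : St n) : 0 ≤ postProb σ ω := by
  refine Finset.prod_nonneg fun i _ => ?_
  cases σ i with
  | none => norm_num
  | some b => by_cases h : ω i = b <;> simp [h]

lemma sum_postProb (σ : Sig n) : ∑ ω, postProb σ ω = 1 :=
  sum_prod_eq_one fun i => sum_postWeight (σ i)

lemma sigProb_nonneg {p : Fin n → ℝ} (hp : ∀ i, 0 < p i ∧ p i ≤ 1) (A : Finset (Fin n))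
    (σ : Sig n) : 0 ≤ sigProb p A σ := by
  refine Finset.prod_nonneg fun i _ => ?_
  have := hp i
  by_cases hi : i ∈ A <;> cases σ i <;> simp [hi] <;> linarith

lemma sum_sigProb (p : Fin n → ℝ) (A : Finset (Fin n)) : ∑ σ, sigProb p A σ = 1 :=
  sum_prod_eq_one (sum_sigWeight p A)

lemma sum_mul_mem_Icc {β : Type*} [Fintype β] {w f : β → ℝ} (hw : ∀ b, 0 ≤ w b)
    (hsum : ∑ b, w b = 1) (hf : ∀ b, f b ∈ Set.Icc (0 : ℝ) 1) :
    ∑ b, w b * f b ∈ Set.Icc (0 : ℝ) 1 :=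
  (convex_Icc (0 : ℝ) 1).sum_mem (fun b _ => hw b) hsum fun b _ => hf b

lemma postExp_postExp_piecewise (D : Finset (Fin n)) (σ τ : Sig n) (f : St n → ℝ) :
    postExp σ (fun ω => postExp τ fun ω' => f (D.piecewise ω' ω)) =
      postExp (D.piecewise τ σ) f := by
  refine (sum_prod_mul_sum_prod_piecewise D (fun i => sum_postWeight (σ i))
    (fun i => sum_postWeight (τ i)) f).trans ?_
  refine Finset.sum_congr rfl fun ω _ => congrArg (· * f ω) (Finset.prod_congr rfl fun i _ => ?_)
  by_cases hi : i ∈ D <;> simp [hi]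

lemma sum_sigProb_mul_sum_sigProb_piecewise (p : Fin n → ℝ) (A D : Finset (Fin n))
    (g : Sig n → ℝ) :
    ∑ σ, sigProb p A σ * ∑ τ, sigProb p D τ * g (D.piecewise τ σ) =
      ∑ ρ, sigProb p (A ∪ D) ρ * g ρ := by
  refine (sum_prod_mul_sum_prod_piecewise D (sum_sigWeight p A) (sum_sigWeight p D) g).trans ?_
  refine Finset.sum_congr rfl fun ρ _ => congrArg (· * g ρ) (Finset.prod_congr rfl fun i _ => ?_)
  by_cases hi : i ∈ D <;> simp [hi]

/-- The scoring rule that applies `S` after replacing the states and the reported signals of the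
tasks in `D` by simulated ones, drawn as if effort were exerted on `D`. -/
noncomputable def simulate (p : Fin n → ℝ) (D : Finset (Fin n)) (S : Sig n → St n → ℝ)
    (σ : Sig n) (ω : St n) : ℝ :=
  ∑ τ, sigProb p D τ * postExp τ fun ω' => S (D.piecewise τ σ) (D.piecewise ω' ω)

lemma simulate_mem_Icc {p : Fin n → ℝ} (hp : ∀ i, 0 < p i ∧ p i ≤ 1) (D : Finset (Fin n))
    {S : Sig n → St n → ℝ} (hS : ∀ σ ω, S σ ω ∈ Set.Icc (0 : ℝ) 1) (σ : Sig n) (ω : St n) :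
    simulate p D S σ ω ∈ Set.Icc (0 : ℝ) 1 :=
  sum_mul_mem_Icc (sigProb_nonneg hp D) (sum_sigProb p D) fun τ =>
    sum_mul_mem_Icc (postProb_nonneg τ) (sum_postProb τ) fun _ => hS _ _

lemma postExp_simulate (p : Fin n → ℝ) (D : Finset (Fin n)) (S : Sig n → St n → ℝ)
    (σ σ' : Sig n) :
    postExp σ (simulate p D S σ') =
      ∑ τ, sigProb p D τ * postExp (D.piecewise τ σ) (S (D.piecewise τ σ')) := by
  simp_rw [← postExp_postExp_piecewise]
  change ∑ ω, postProb σ ω * ∑ τ, sigProb p D τ * postExp τ _ =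
    ∑ τ, sigProb p D τ * ∑ ω, postProb σ ω * postExp τ _
  simp_rw [Finset.mul_sum]
  rw [Finset.sum_comm]
  exact Finset.sum_congr rfl fun τ _ => Finset.sum_congr rfl fun ω _ => mul_left_comm _ _ _

lemma Proper.simulate {p : Fin n → ℝ} (hp : ∀ i, 0 < p i ∧ p i ≤ 1) (D : Finset (Fin n))
    {S : Sig n → St n → ℝ} (hS : Proper S) : Proper (simulate p D S) := fun σ σ' => by
  simp_rw [postExp_simulate]
  exact Finset.sum_le_sum fun τ _ =>
    mul_le_mul_of_nonneg_left (hS _ _) (sigProb_nonneg hp D τ)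

lemma expScore_simulate (p : Fin n → ℝ) (A D : Finset (Fin n)) (S : Sig n → St n → ℝ) :
    expScore p A (simulate p D S) = expScore p (A ∪ D) S := by
  simp_rw [expScore, postExp_simulate]
  exact sum_sigProb_mul_sum_sigProb_piecewise p A D fun ρ => postExp ρ (S ρ)

end KS

/-- Monotonicity in tasks: if `Ψ` can be incentivized by a proper scoring rule
with values in `[0,1]`, so can every subset `Ψ' ⊆ Ψ`. -/
theorem stmt2 {n : ℕ} (p c : Fin n → ℝ)
    (hp : ∀ i, 0 < p i ∧ p i ≤ 1) (hc : ∀ i, 0 < c i)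
    (Ψ : Finset (Fin n)) (S : KS.Sig n → KS.St n → ℝ)
    (hbd : ∀ σ ω, S σ ω ∈ Set.Icc (0:ℝ) 1) (hIC : KS.IC p c S Ψ)
    (Ψ' : Finset (Fin n)) (hsub : Ψ' ⊆ Ψ) :
    ∃ S' : KS.Sig n → KS.St n → ℝ,
      (∀ σ ω, S' σ ω ∈ Set.Icc (0:ℝ) 1) ∧ KS.IC p c S' Ψ' := by
  refine ⟨KS.simulate p (Ψ \ Ψ') S, KS.simulate_mem_Icc hp _ hbd, hIC.1.simulate hp _, fun A => ?_⟩
  rw [KS.expScore_simulate, KS.expScore_simulate, Finset.union_sdiff_of_subset hsub]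
  have hopt := hIC.2 (A ∪ Ψ \ Ψ')
  have hsplit := Finset.sum_sdiff (f := c) hsub
  have hunion := Finset.sum_union_inter (s₁ := A) (s₂ := Ψ \ Ψ') (f := c)
  have hinter : 0 ≤ ∑ i ∈ A ∩ (Ψ \ Ψ'), c i := Finset.sum_nonneg fun i _ => (hc i).le
  linarith
end
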